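/- arXiv:1903.02693 — 2 statements merged into one kernel-verified Lean document; each statement's English description precedes it below -/
import Mathlib

section
/- For every ρ > 0 there exists a function η : ℝ → ℝ such that: (i) η is infinitely differentiable; (ii) η is convex on ℝ; (iii) η(r) = max(r, 0) whenever |r| ≥ ρ; (iv) 0 ≤ η′(r) ≤ 1 for all r; (v) η′(−r) = 1 − η′(r) for all r; (vi) η″(r) ≥ 0 for all r and η″(r) = 0 whenever |r| > ρ; (vii) there is a constant K > 0, independent of ρ, with η″(r) ≤ K/ρ for all r. -/
open MeasureTheory

/-- The smooth odd-symmetric step from `0` to `1` across `[-1, 1]`. -/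
noncomputable def symmStep (x : ℝ) : ℝ := Real.smoothTransition ((x + 1) / 2)

lemma symmStep_contDiff : ContDiff ℝ (⊤ : ℕ∞) symmStep := by
  unfold symmStep
  exact Real.smoothTransition.contDiff.comp (by fun_prop)

lemma symmStep_monotone : Monotone symmStep := fun x y h =>
  Real.smoothTransition.monotone (by linarith)

lemma symmStep_neg (x : ℝ) : symmStep (-x) = 1 - symmStep x := by
  have h := (Real.smoothTransition.pos_denom ((x + 1) / 2)).ne'
  have h1 : (-x + 1) / 2 = 1 - (x + 1) / 2 := by ring
  unfold symmStep
  rw [h1]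
  unfold Real.smoothTransition
  rw [sub_sub_cancel, add_comm (expNegInvGlue (1 - _)), eq_sub_iff_add_eq, ← add_div,
    add_comm (expNegInvGlue (1 - _)), div_self h]

lemma symmStep_of_le {x : ℝ} (h : x ≤ -1) : symmStep x = 0 :=
  Real.smoothTransition.zero_of_nonpos (by linarith)

lemma symmStep_of_ge {x : ℝ} (h : 1 ≤ x) : symmStep x = 1 :=
  Real.smoothTransition.one_of_one_le (by linarith)

lemma deriv_symmStep_eq_zero {x : ℝ} (h : 1 < |x|) : deriv symmStep x = 0 := by
  rcases lt_abs.1 h with h | h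
  · have : symmStep =ᶠ[nhds x] fun _ => 1 := by
      filter_upwards [lt_mem_nhds h] with y hy using symmStep_of_ge hy.le
    simp [this.deriv_eq]
  · have : symmStep =ᶠ[nhds x] fun _ => 0 := by
      filter_upwards [gt_mem_nhds (show x < -1 by linarith)] with y hy using symmStep_of_le hy.le
    simp [this.deriv_eq]

lemma exists_deriv_symmStep_le : ∃ K : ℝ, 0 < K ∧ ∀ x, deriv symmStep x ≤ K := by
  have hc : Continuous (deriv symmStep) := symmStep_contDiff.continuous_deriv (by simp)
  obtain ⟨C, hC⟩ := (isCompact_Icc (a := (-1 : ℝ)) (b := 1)).bddAbove_image hc.continuousOn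
  refine ⟨max C 1, by positivity, fun x => ?_⟩
  by_cases h : 1 < |x|
  · rw [deriv_symmStep_eq_zero h]
    positivity
  · exact (hC ⟨x, abs_le.1 (not_lt.1 h), rfl⟩).trans (le_max_left _ _)

/-- The primitive of `symmStep` vanishing at `-1`. -/
noncomputable def smoothPosPart (x : ℝ) : ℝ := ∫ t in (-1)..x, symmStep t

lemma hasDerivAt_smoothPosPart (x : ℝ) : HasDerivAt smoothPosPart (symmStep x) x :=
  symmStep_contDiff.continuous.integral_hasStrictDerivAt (-1) x |>.hasDerivAt

lemma smoothPosPart_of_le {x : ℝ} (h : x ≤ -1) : smoothPosPart x = 0 := by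
  unfold smoothPosPart
  rw [intervalIntegral.integral_congr (g := fun _ => 0)]
  · simp
  · intro t ht
    rw [Set.uIcc_of_ge h] at ht
    exact symmStep_of_le ht.2

lemma smoothPosPart_sub_neg (x : ℝ) : smoothPosPart x - smoothPosPart (-x) = x := by
  have hd (y : ℝ) :
      HasDerivAt (fun z => smoothPosPart z - smoothPosPart (-z) - z) 0 y := by
    have h := ((hasDerivAt_smoothPosPart y).sub
      ((hasDerivAt_smoothPosPart (-y)).scomp y (hasDerivAt_neg y))).sub (hasDerivAt_id y)
    exact h.congr_deriv (by simp [symmStep_neg])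
  have h := is_const_of_deriv_eq_zero (fun y => (hd y).differentiableAt)
    (fun y => (hd y).deriv) x 0
  simp only [neg_zero, sub_self] at h
  linarith

lemma smoothPosPart_eq_max {x : ℝ} (h : 1 ≤ |x|) : smoothPosPart x = max x 0 := by
  rcases le_abs.1 h with h | h
  · have h1 := smoothPosPart_sub_neg x
    rw [smoothPosPart_of_le (by linarith : -x ≤ -1)] at h1
    rw [max_eq_left (by linarith)]
    linarith
  · rw [smoothPosPart_of_le (by linarith), max_eq_right (by linarith)]

/-- Construction of the smooth symmetric convex approximation `η_ρ` of the
positive-part function (Section 3 of the paper): there is a constant `K > 0`,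
independent of `ρ`, such that for every `ρ > 0` there exists a smooth convex
`η : ℝ → ℝ` agreeing with `r ↦ max r 0` for `|r| ≥ ρ`, with `0 ≤ η' ≤ 1`,
`η'(-r) = 1 - η'(r)`, `η'' ≥ 0`, `η''` supported in `[-ρ, ρ]`, and `η'' ≤ K/ρ`. -/
theorem stmt1 :
    ∃ K : ℝ, 0 < K ∧ ∀ ρ : ℝ, 0 < ρ →
      ∃ η : ℝ → ℝ,
        ContDiff ℝ (⊤ : ℕ∞) η ∧
        ConvexOn ℝ Set.univ η ∧
        (∀ r : ℝ, ρ ≤ |r| → η r = max r 0) ∧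
        (∀ r : ℝ, 0 ≤ deriv η r ∧ deriv η r ≤ 1) ∧
        (∀ r : ℝ, deriv η (-r) = 1 - deriv η r) ∧
        (∀ r : ℝ, 0 ≤ deriv (deriv η) r) ∧
        (∀ r : ℝ, ρ < |r| → deriv (deriv η) r = 0) ∧
        (∀ r : ℝ, deriv (deriv η) r ≤ K / ρ) := by
  obtain ⟨K, hK, hb⟩ := exists_deriv_symmStep_le
  refine ⟨K, hK, fun ρ hρ => ?_⟩
  have hη (r : ℝ) : HasDerivAt (fun r => ρ * smoothPosPart (r / ρ)) (symmStep (r / ρ)) r := by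
    have h := ((hasDerivAt_smoothPosPart (r / ρ)).comp r
      ((hasDerivAt_id r).div_const ρ)).const_mul ρ
    exact h.congr_deriv (by field_simp)
  have hη' : deriv (fun r => ρ * smoothPosPart (r / ρ)) = fun r => symmStep (r / ρ) :=
    funext fun r => (hη r).deriv
  have hη'' (r : ℝ) : deriv (fun r => symmStep (r / ρ)) r = deriv symmStep (r / ρ) / ρ := by
    have hs : HasDerivAt symmStep (deriv symmStep (r / ρ)) (r / ρ) :=
      (symmStep_contDiff.differentiable (by simp) _).hasDerivAt
    exact (hs.comp r ((hasDerivAt_id r).div_const ρ)).deriv.trans (mul_one_div _ _)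
  have hdiff : Differentiable ℝ (fun r => ρ * smoothPosPart (r / ρ)) :=
    fun r => (hη r).differentiableAt
  have habs (r : ℝ) : |r / ρ| = |r| / ρ := by rw [abs_div, abs_of_pos hρ]
  refine ⟨fun r => ρ * smoothPosPart (r / ρ), ?_, ?_, ?_, ?_, ?_, ?_, ?_, ?_⟩
  · rw [contDiff_infty_iff_deriv, hη']
    exact ⟨hdiff, symmStep_contDiff.comp (contDiff_id.div_const ρ)⟩
  · refine Monotone.convexOn_univ_of_deriv hdiff ?_
    rw [hη']
    exact fun a b h => symmStep_monotone (by gcongr)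
  · intro r hr
    have h : 1 ≤ |r / ρ| := by rwa [habs, one_le_div hρ]
    beta_reduce
    rw [smoothPosPart_eq_max h, mul_max_of_nonneg _ _ hρ.le, mul_zero, mul_div_cancel₀ _ hρ.ne']
  · intro r
    rw [hη']
    exact ⟨Real.smoothTransition.nonneg _, Real.smoothTransition.le_one _⟩
  · intro r
    simp only [hη', neg_div, symmStep_neg]
  · intro r
    rw [hη', hη'']
    exact div_nonneg symmStep_monotone.deriv_nonneg hρ.le
  · intro r hr
    have h : 1 < |r / ρ| := by rwa [habs, one_lt_div hρ]
    rw [hη', hη'', deriv_symmStep_eq_zero h, zero_div]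
  · intro r
    rw [hη', hη'']
    exact div_le_div_of_nonneg_right (hb _) hρ.le
end

section
/- Let d ≥ 1 and let 𝕋ᵈ denote the d-dimensional torus (Fin d → AddCircle 1) equipped with its translation-invariant Haar probability measure. Let ρ > 0, let u, v : 𝕋ᵈ → ℝ be integrable, let J : 𝕋ᵈ → [0,∞) be measurable with ∫_{𝕋ᵈ} J = 1, and let η : ℝ → ℝ be measurable with 0 ≤ η(r) − max(r,0) ≤ ρ for all r ∈ ℝ. Then |∫_{𝕋ᵈ}∫_{𝕋ᵈ} η(v(y) − u(x)) J(y − x) dy dx − ∫_{𝕋ᵈ} max(v(x) − u(x), 0) dx| ≤ ρ + ∫_{𝕋ᵈ}∫_{𝕋ᵈ} |u(y) − u(x)| J(y − x) dy dx. -/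
open MeasureTheory

section Group

variable {G : Type*} [MeasurableSpace G] [AddGroup G] [MeasurableAdd₂ G] [MeasurableNeg G]
  {μ : Measure G} [SFinite μ] [μ.IsAddRightInvariant] {f J : G → ℝ}

/-- A function of the first variable times an integrable kernel evaluated at the difference is
integrable on the product. -/
lemma integrable_fst_mul_sub (hf : Integrable f μ) (hJ : Integrable J μ) :
    Integrable (fun z : G × G => f z.1 * J (z.2 - z.1)) (μ.prod μ) :=
  (measurePreserving_prod_sub μ μ).integrable_comp_of_integrable (hf.mul_prod hJ)

variable [μ.IsNegInvariant]

/-- The map `(x, y) ↦ (y - x, y)` is measure-preserving. -/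
lemma measurePreserving_rev_sub_prod :
    MeasurePreserving (fun z : G × G => (z.2 - z.1, z.2)) (μ.prod μ) (μ.prod μ) := by
  simpa [Function.comp_def] using
    ((Measure.measurePreserving_neg μ).prod (.id μ)).comp (measurePreserving_sub_prod μ μ)

/-- A function of the second variable times an integrable kernel evaluated at the difference is
integrable on the product. -/
lemma integrable_snd_mul_sub (hf : Integrable f μ) (hJ : Integrable J μ) :
    Integrable (fun z : G × G => f z.2 * J (z.2 - z.1)) (μ.prod μ) := by
  simpa only [Function.comp_def, mul_comm] using
    measurePreserving_rev_sub_prod.integrable_comp_of_integrable (hJ.mul_prod hf)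

lemma integral_snd_mul_sub (hf : Integrable f μ) (hJ : Integrable J μ) :
    ∫ z : G × G, f z.2 * J (z.2 - z.1) ∂μ.prod μ = (∫ x, f x ∂μ) * ∫ x, J x ∂μ := by
  have hmp := measurePreserving_rev_sub_prod (μ := μ)
  have hint := hJ.mul_prod hf
  have h := integral_map hmp.aemeasurable (hmp.map_eq.symm ▸ hint.aestronglyMeasurable)
  rw [hmp.map_eq, integral_prod_mul] at h
  simpa only [mul_comm] using h.symm

/-- Replacing a regularized positive part with doubled variables by the positive part on the
diagonal costs at most the regularization error plus the mollification error of `u`. -/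
theorem abs_integral_doubled_sub_integral_posPart_le [IsProbabilityMeasure μ] {ρ : ℝ}
    {u v : G → ℝ} (hu : Integrable u μ) (hv : Integrable v μ) (hJm : Integrable J μ)
    (hJ0 : ∀ x, 0 ≤ J x) (hJ1 : ∫ x, J x ∂μ = 1) {η : ℝ → ℝ} (hηm : Measurable η)
    (hη : ∀ r : ℝ, 0 ≤ η r - max r 0 ∧ η r - max r 0 ≤ ρ) :
    |(∫ x, ∫ y, η (v y - u x) * J (y - x) ∂μ ∂μ) - ∫ x, max (v x - u x) 0 ∂μ| ≤
      ρ + ∫ x, ∫ y, |u y - u x| * J (y - x) ∂μ ∂μ := by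
  have hρJ : Integrable (fun z : G × G => ρ * J (z.2 - z.1)) (μ.prod μ) :=
    integrable_snd_mul_sub (integrable_const ρ) hJm
  have hJsub : AEStronglyMeasurable (fun z : G × G => J (z.2 - z.1)) (μ.prod μ) := by
    simpa using (integrable_snd_mul_sub (integrable_const (1 : ℝ)) hJm).aestronglyMeasurable
  have hpos : Integrable (fun x => max (v x - u x) 0) μ := (hv.sub hu).pos_part
  have hA : Integrable (fun z : G × G => η (v z.2 - u z.1) * J (z.2 - z.1)) (μ.prod μ) := by
    refine (((integrable_snd_mul_sub hv.abs hJm).add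
      (integrable_fst_mul_sub hu.abs hJm)).add hρJ).mono' ?_ (ae_of_all _ fun z => ?_)
    · exact (hηm.comp_aemeasurable (hv.aemeasurable.comp_snd.sub
        hu.aemeasurable.comp_fst)).aestronglyMeasurable.mul hJsub
    · rw [norm_mul, Real.norm_of_nonneg (hJ0 _), Real.norm_eq_abs]
      simp only [Pi.add_apply, ← add_mul]
      refine mul_le_mul_of_nonneg_right ?_ (hJ0 _)
      have := hη (v z.2 - u z.1)
      grind
  have hB := integrable_snd_mul_sub hpos hJm
  have hC : Integrable (fun z : G × G => |u z.2 - u z.1| * J (z.2 - z.1)) (μ.prod μ) := by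
    refine ((integrable_snd_mul_sub hu hJm).sub (integrable_fst_mul_sub hu hJm)).abs.congr
      (ae_of_all _ fun z => ?_)
    simp only [Pi.sub_apply, ← sub_mul, abs_mul, abs_of_nonneg (hJ0 _)]
  have hBint := integral_snd_mul_sub hpos hJm
  have hρint := integral_snd_mul_sub (integrable_const (μ := μ) ρ) hJm
  simp only [hJ1, mul_one, integral_const, probReal_univ, one_smul] at hBint hρint
  rw [← integral_prod _ hA, ← integral_prod _ hC, ← hBint, ← integral_sub hA hB]
  conv_rhs => rw [← hρint]
  rw [← integral_add hρJ hC, ← Real.norm_eq_abs]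
  refine norm_integral_le_of_norm_le (hρJ.add hC) (ae_of_all _ fun z => ?_)
  rw [← sub_mul, norm_mul, Real.norm_of_nonneg (hJ0 _), Real.norm_eq_abs, ← add_mul]
  refine mul_le_mul_of_nonneg_right ?_ (hJ0 _)
  have := hη (v z.2 - u z.1)
  grind

end Group

/-- Deterministic core of the mollification-error estimate in Step 1 of Theorem
6.1, on the torus `𝕋ᵈ = (Fin d → AddCircle 1)` with its Haar probability measure:
if `0 ≤ η(r) - (r)_+ ≤ ρ` and `J ≥ 0` has unit mass, the doubled-variable
regularized functional differs from `∫ (v - u)_+` by at most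
`ρ + ∫∫ |u(y) - u(x)| J(y - x)`. -/
theorem stmt9 (d : ℕ) (hd : 1 ≤ d) (ρ : ℝ) (hρ : 0 < ρ)
    (u v : (Fin d → AddCircle (1 : ℝ)) → ℝ)
    (hu : Integrable u) (hv : Integrable v)
    (J : (Fin d → AddCircle (1 : ℝ)) → ℝ) (hJm : Measurable J)
    (hJ0 : ∀ x, 0 ≤ J x) (hJ1 : ∫ x, J x = 1)
    (η : ℝ → ℝ) (hηm : Measurable η)
    (hη : ∀ r : ℝ, 0 ≤ η r - max r 0 ∧ η r - max r 0 ≤ ρ) :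
    |(∫ x, ∫ y, η (v y - u x) * J (y - x)) - ∫ x, max (v x - u x) 0| ≤
      ρ + ∫ x, ∫ y, |u y - u x| * J (y - x) := by
  have : IsProbabilityMeasure (volume : Measure (AddCircle (1 : ℝ))) :=
    ⟨by simp [AddCircle.measure_univ]⟩
  have : (volume : Measure (Fin d → AddCircle (1 : ℝ))).IsNegInvariant :=
    Measure.IsAddHaarMeasure.isNegInvariant_of_regular _
  have hJ : Integrable J := .of_integral_ne_zero (by simp [hJ1])
  exact abs_integral_doubled_sub_integral_posPart_le hu hv hJ hJ0 hJ1 hηm hη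
end
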